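/- arXiv:2308.07190 — 2 statements merged into one kernel-verified Lean document; each statement's English description precedes it below -/
import Mathlib

section
/- There exists a constant C > 0 such that for all real numbers a, b and all integers k₁, k₂, k₃, k₄ satisfying |k₄| > 8·max{1, |a|, |b|}, 4·|k₃| ≥ |k₄| ≥ |k₃|, and |k₃+k₄| > 16·|k₂| ≥ 16·|k₁| (so that Φ_a^(4)(k₁,k₂,k₃,k₄) ≠ 0 and Φ_b^(4)(k₁,k₂,k₃,k₄) ≠ 0), one has |1/Φ_a^(4)(k₁,k₂,k₃,k₄) − 1/Φ_b^(4)(k₁,k₂,k₃,k₄)| ≤ C · (|a−b| / |k₄|²) · min{ 1/|Φ_a^(4)(k₁,k₂,k₃,k₄)|, 1/|Φ_b^(4)(k₁,k₂,k₃,k₄)| }. -/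
/-- `p a k = -k^5 + a·k^3`, the linear dispersion symbol (phase divided by `i`). -/
noncomputable def p (a : ℝ) (k : ℤ) : ℝ := -(k : ℝ) ^ 5 + a * (k : ℝ) ^ 3

/-- The quartic phase function `Φ_a^(4)`. -/
noncomputable def Phi4 (a : ℝ) (k₁ k₂ k₃ k₄ : ℤ) : ℝ :=
  p a (k₁ + k₂ + k₃ + k₄) - (p a k₁ + p a k₂ + p a k₃ + p a k₄)

/-- The normalized quintic resonance is bounded below. -/
lemma normalized_quintic_lower {t u v : ℝ} (ht : 1 / 4 ≤ |t|) (ht' : |t| ≤ 1)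
    (hu : |u| ≤ 1 / 16) (hv : |v| ≤ 1 / 16) :
    1 / 20 ≤ |t * (1 + t + t ^ 2) + (1 + t) ^ 4 *
      ((u + v) * (1 + 2 * (u + v) + 2 * (u + v) ^ 2 + (u + v) ^ 3) +
        u * v * (u + v) * (u ^ 2 + u * v + v ^ 2))| := by
  have hw : |u + v| ≤ 1 / 8 := (abs_add_le u v).trans (by linarith)
  have hsmall : |u * v * (u + v) * (u ^ 2 + u * v + v ^ 2)| ≤ 1 / 1000 := by
    have hq : |u ^ 2 + u * v + v ^ 2| ≤ 1 := by
      obtain ⟨hu₁, hu₂⟩ := abs_le.mp hu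
      obtain ⟨hv₁, hv₂⟩ := abs_le.mp hv
      rw [abs_le]
      constructor <;> nlinarith
    calc |u * v * (u + v) * (u ^ 2 + u * v + v ^ 2)|
        = |u| * |v| * |u + v| * |u ^ 2 + u * v + v ^ 2| := by simp only [abs_mul]
      _ ≤ 1 / 16 * (1 / 16) * (1 / 8) * 1 := by gcongr
      _ ≤ 1 / 1000 := by norm_num
  generalize u * v * (u + v) * (u ^ 2 + u * v + v ^ 2) = e at hsmall ⊢
  generalize u + v = w at hw ⊢
  obtain ⟨he₁, he₂⟩ := abs_le.mp hsmall
  obtain ⟨hw₁, hw₂⟩ := abs_le.mp hw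
  have hP₁ : -(1 / 10) ≤ w * (1 + 2 * w + 2 * w ^ 2 + w ^ 3) + e := by
    have hg : 0 ≤ w ^ 3 + 15 / 8 * w ^ 2 + 113 / 64 * w + 399 / 512 := by
      nlinarith [mul_nonneg (sq_nonneg w) (by linarith : 0 ≤ w + 1 / 8), sq_nonneg w]
    nlinarith [mul_nonneg (by linarith : 0 ≤ w + 1 / 8) hg]
  have hP₂ : w * (1 + 2 * w + 2 * w ^ 2 + w ^ 3) + e ≤ 17 / 100 := by
    have hw2 : w ^ 2 ≤ 1 / 64 := by nlinarith
    have hw3 : w ^ 3 ≤ 1 / 512 := by nlinarith [sq_nonneg w]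
    have hw4 : w ^ 4 ≤ 1 / 4096 := by nlinarith [sq_nonneg w]
    nlinarith
  generalize w * (1 + 2 * w + 2 * w ^ 2 + w ^ 3) + e = P at hP₁ hP₂ ⊢
  obtain ⟨ht₁, ht₂⟩ := abs_le.mp ht'
  have h4 : 0 ≤ (1 + t) ^ 4 := by positivity
  rw [le_abs] at ht ⊢
  rcases ht with ht | ht
  · left
    have ht3 : 0 ≤ t ^ 3 * (6 - t) := mul_nonneg (by positivity) (by linarith)
    nlinarith [mul_le_mul_of_nonneg_left hP₁ h4, sq_nonneg t]
  · right
    have h2 : (1 + t) ^ 2 ≤ 9 / 16 := by nlinarith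
    have h4' : (1 + t) ^ 4 ≤ 81 / 256 := by nlinarith [sq_nonneg (1 + t)]
    have hq : 3 / 4 ≤ 1 + t + t ^ 2 := by nlinarith [sq_nonneg (t + 1 / 2)]
    nlinarith [mul_le_mul_of_nonneg_left hP₂ h4,
      mul_le_mul_of_nonneg_left hq (by linarith : 0 ≤ -t)]

/-- The normalized cubic resonance is bounded above. -/
lemma normalized_cubic_upper {t u v : ℝ} (ht : |t| ≤ 1)
    (hu : |u| ≤ 1 / 16) (hv : |v| ≤ 1 / 16) :
    |t + (1 + t) ^ 2 * ((u + v) + (u + v) ^ 2 + u * v * (u + v))| ≤ 5 / 3 := by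
  have hw : |u + v| ≤ 1 / 8 := (abs_add_le u v).trans (by linarith)
  have h1 : |1 + t| ≤ 2 := (abs_add_le 1 t).trans (by rw [abs_one]; linarith)
  calc |t + (1 + t) ^ 2 * ((u + v) + (u + v) ^ 2 + u * v * (u + v))|
      ≤ |t| + |1 + t| ^ 2 * (|u + v| + |u + v| ^ 2 + |u| * |v| * |u + v|) := by
        refine (abs_add_le _ _).trans ?_
        rw [abs_mul, abs_pow]
        gcongr
        refine (abs_add_three _ _ _).trans ?_
        simp only [abs_mul, abs_pow, le_refl]
    _ ≤ 1 + 2 ^ 2 * (1 / 8 + (1 / 8) ^ 2 + 1 / 16 * (1 / 16) * (1 / 8)) := by gcongr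
    _ ≤ 5 / 3 := by norm_num

/-- The quintic resonance dominates the cubic one when `x ∼ y` and `k`, `l` are small
relative to `x + y`. -/
lemma sq_mul_abs_cubic_le_abs_quintic {k l x y : ℝ} (hx : |y| ≤ 4 * |x|) (hxy : |x| ≤ |y|)
    (hl : 16 * |l| < |x + y|) (hkl : |k| ≤ |l|) :
    y ^ 2 * |(k + l + x + y) ^ 3 - (k ^ 3 + l ^ 3 + x ^ 3 + y ^ 3)| ≤
      20 * |(k + l + x + y) ^ 5 - (k ^ 5 + l ^ 5 + x ^ 5 + y ^ 5)| := by
  have hm : 0 < |x + y| := (by positivity : 0 ≤ 16 * |l|).trans_lt hl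
  have hy : 0 < |y| := by linarith [abs_add_le x y]
  have hy0 : y ≠ 0 := abs_pos.mp hy
  have hm0 : x + y ≠ 0 := abs_pos.mp hm
  obtain ⟨t, rfl⟩ : ∃ t, x = t * y := ⟨x / y, by field_simp⟩
  obtain ⟨u, hu⟩ : ∃ u, k = u * (t * y + y) := ⟨k / (t * y + y), (div_mul_cancel₀ k hm0).symm⟩
  obtain ⟨v, hv⟩ : ∃ v, l = v * (t * y + y) := ⟨l / (t * y + y), (div_mul_cancel₀ l hm0).symm⟩
  have hv' : |v| ≤ 1 / 16 := by
    rw [hv, abs_mul] at hl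
    nlinarith
  have hu' : |u| ≤ 1 / 16 := by
    rw [hu, hv, abs_mul, abs_mul] at hkl
    exact (le_of_mul_le_mul_right hkl hm).trans hv'
  rw [abs_mul] at hx hxy
  have ht : 1 / 4 ≤ |t| := by nlinarith
  have ht' : |t| ≤ 1 := by nlinarith
  have h3 := normalized_cubic_upper ht' hu' hv'
  have h5 := normalized_quintic_lower ht ht' hu' hv'
  have e3 : (k + l + t * y + y) ^ 3 - (k ^ 3 + l ^ 3 + (t * y) ^ 3 + y ^ 3) =
      3 * (t * y + y) * y ^ 2 *
        (t + (1 + t) ^ 2 * ((u + v) + (u + v) ^ 2 + u * v * (u + v))) := by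
    rw [hu, hv]; ring
  have e5 : (k + l + t * y + y) ^ 5 - (k ^ 5 + l ^ 5 + (t * y) ^ 5 + y ^ 5) =
      5 * (t * y + y) * y ^ 4 * (t * (1 + t + t ^ 2) + (1 + t) ^ 4 *
      ((u + v) * (1 + 2 * (u + v) + 2 * (u + v) ^ 2 + (u + v) ^ 3) +
        u * v * (u + v) * (u ^ 2 + u * v + v ^ 2))) := by
    rw [hu, hv]; ring
  rw [e3, e5, abs_mul, abs_mul (5 * (t * y + y) * y ^ 4)]
  have n3 : |3 * (t * y + y) * y ^ 2| = 3 * |t * y + y| * y ^ 2 := by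
    simp [abs_mul]
  have n5 : |5 * (t * y + y) * y ^ 4| = 5 * |t * y + y| * y ^ 4 := by
    rw [abs_mul, abs_mul, abs_of_nonneg (by positivity : 0 ≤ y ^ 4)]; simp
  rw [n3, n5]
  generalize |t + _| = X at h3 ⊢
  generalize |t * (1 + t + t ^ 2) + _| = Z at h5 ⊢
  have hc : 0 ≤ |t * y + y| * y ^ 4 := by positivity
  linarith [mul_le_mul_of_nonneg_left h3 hc, mul_le_mul_of_nonneg_left h5 hc]

/-- A perturbation bound for the reciprocals of two affine functions with the same slope. -/
lemma abs_one_div_sub_one_div_le {A B K M d : ℝ} (hM : 0 < M) (hd : |A - B| = d * |K|)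
    (hd0 : 0 ≤ d) (hA : M * |K| ≤ |A|) (hB : M * |K| ≤ |B|) :
    |1 / A - 1 / B| ≤ d / M * min (1 / |A|) (1 / |B|) := by
  by_cases hAB : A = B
  · rw [hAB, sub_self, abs_zero]
    positivity
  have hK : 0 < |K| := by
    refine lt_of_le_of_ne (abs_nonneg K) fun h => hAB ?_
    rwa [← h, mul_zero, abs_eq_zero, sub_eq_zero] at hd
  have hA' : 0 < |A| := (mul_pos hM hK).trans_le hA
  have hB' : 0 < |B| := (mul_pos hM hK).trans_le hB
  have key : |1 / A - 1 / B| = d * |K| / (|A| * |B|) := by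
    rw [div_sub_div _ _ (abs_pos.mp hA') (abs_pos.mp hB'), abs_div, abs_mul, one_mul, mul_one,
      abs_sub_comm, hd]
  rw [key, mul_min_of_nonneg _ _ (by positivity), le_min_iff]
  constructor
  · rw [div_mul_div_comm, div_le_div_iff₀ (by positivity) (by positivity)]
    nlinarith [mul_le_mul_of_nonneg_left hB (by positivity : 0 ≤ d * |A|)]
  · rw [div_mul_div_comm, div_le_div_iff₀ (by positivity) (by positivity)]
    nlinarith [mul_le_mul_of_nonneg_left hA (by positivity : 0 ≤ d * |B|)]

/-- Difference estimate for reciprocals of quartic phases when `|k₃| ∼ |k₄|` dominate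
`|k₁|, |k₂|`. -/
theorem phi4_reciprocal_difference_comparable :
    ∃ C : ℝ, 0 < C ∧ ∀ (a b : ℝ) (k₁ k₂ k₃ k₄ : ℤ),
      ((|k₄| : ℤ) : ℝ) > 8 * max 1 (max |a| |b|) →
      4 * |k₃| ≥ |k₄| → |k₄| ≥ |k₃| →
      |k₃ + k₄| > 16 * |k₂| → 16 * |k₂| ≥ 16 * |k₁| →
      |1 / Phi4 a k₁ k₂ k₃ k₄ - 1 / Phi4 b k₁ k₂ k₃ k₄| ≤
        C * (|a - b| / ((|k₄| : ℤ) : ℝ) ^ 2) *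
          min (1 / |Phi4 a k₁ k₂ k₃ k₄|) (1 / |Phi4 b k₁ k₂ k₃ k₄|) := by
  refine ⟨30, by norm_num, fun a b k₁ k₂ k₃ k₄ hk₄ h₃₄ h₄₃ h₂ h₁₂ => ?_⟩
  have hmax := le_max_left (1 : ℝ) (max |a| |b|)
  have hmax' := le_max_right (1 : ℝ) (max |a| |b|)
  have ha := (le_max_left |a| |b|).trans hmax'
  have hb := (le_max_right |a| |b|).trans hmax'
  have h₃₄' : |(k₄ : ℝ)| ≤ 4 * |(k₃ : ℝ)| := by exact_mod_cast h₃₄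
  have h₄₃' : |(k₃ : ℝ)| ≤ |(k₄ : ℝ)| := by exact_mod_cast h₄₃
  have h₂' : 16 * |(k₂ : ℝ)| < |(k₃ : ℝ) + k₄| := by exact_mod_cast h₂
  have h₁₂' : |(k₁ : ℝ)| ≤ |(k₂ : ℝ)| := by
    have : |k₁| ≤ |k₂| := by linarith
    exact_mod_cast this
  have hdom := sq_mul_abs_cubic_le_abs_quintic h₃₄' h₄₃' h₂' h₁₂'
  rw [Int.cast_abs] at hk₄ ⊢
  rw [sq_abs]
  set K := ((k₁ : ℝ) + k₂ + k₃ + k₄) ^ 3 - (k₁ ^ 3 + k₂ ^ 3 + k₃ ^ 3 + k₄ ^ 3) with hK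
  set Q := ((k₁ : ℝ) + k₂ + k₃ + k₄) ^ 5 - (k₁ ^ 5 + k₂ ^ 5 + k₃ ^ 5 + k₄ ^ 5) with hQ
  have hPhi (c : ℝ) : Phi4 c k₁ k₂ k₃ k₄ = c * K - Q := by
    simp only [Phi4, p, hK, hQ]
    push_cast
    ring
  have hy : 64 * max 1 (max |a| |b|) ≤ (k₄ : ℝ) ^ 2 := by
    rw [← sq_abs]
    nlinarith
  have hlower (c : ℝ) (hc : |c| ≤ max 1 (max |a| |b|)) :
      (k₄ : ℝ) ^ 2 / 30 * |K| ≤ |c * K - Q| := by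
    have htri : |Q| - |c| * |K| ≤ |c * K - Q| := by
      rw [← abs_mul, abs_sub_comm (c * K)]
      exact abs_sub_abs_le_abs_sub Q (c * K)
    have hcK : 64 * (|c| * |K|) ≤ (k₄ : ℝ) ^ 2 * |K| := by
      nlinarith [mul_le_mul_of_nonneg_right
        (show 64 * |c| ≤ (k₄ : ℝ) ^ 2 by linarith) (abs_nonneg K)]
    have : 0 ≤ (k₄ : ℝ) ^ 2 * |K| := by positivity
    linarith
  have hfin := abs_one_div_sub_one_div_le (A := a * K - Q) (B := b * K - Q) (K := K)
    (M := (k₄ : ℝ) ^ 2 / 30) (d := |a - b|) (by linarith)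
    (by rw [← abs_mul]; congr 1; ring) (abs_nonneg _) (hlower a ha) (hlower b hb)
  rw [hPhi, hPhi]
  convert hfin using 2
  rw [div_div_eq_mul_div]
  ring
end

section
/- For every real s ≥ 1 and every integer N ≥ 1 there exists a constant C > 0 such that for all functions v₁, …, v_N : ℤ → [0,∞): ( Σ_{k∈ℤ} ⟨k⟩^{2(s−3)} · ( Σ_{k₁+⋯+k_N = k} ⟨k⟩ · (max_{1≤j≤N} ⟨k_j⟩)² · Π_{l=1}^N v_l(k_l) )² )^{1/2} ≤ C · Π_{l=1}^N ( Σ_{k∈ℤ} ⟨k⟩^{2s} v_l(k)² )^{1/2}, where the inner sum ranges over all N-tuples (k₁,…,k_N) ∈ ℤ^N with k₁+⋯+k_N = k and all sums are interpreted in [0,∞]. -/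
open scoped ENNReal NNReal BigOperators

/-- The Japanese bracket `⟨k⟩ = (1+k²)^{1/2}`, as an extended nonnegative real. -/
noncomputable def J (k : ℤ) : ℝ≥0∞ := ENNReal.ofReal (Real.sqrt (1 + (k : ℝ) ^ 2))

theorem one_le_J (k : ℤ) : 1 ≤ J k := by
  rw [J, ENNReal.one_le_ofReal, Real.one_le_sqrt]
  nlinarith [sq_nonneg (k : ℝ)]

theorem J_ne_zero (k : ℤ) : J k ≠ 0 := (zero_lt_one.trans_le (one_le_J k)).ne'

theorem J_ne_top (k : ℤ) : J k ≠ ∞ := ENNReal.ofReal_ne_top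

theorem J_neg (k : ℤ) : J (-k) = J k := by simp [J]

theorem J_add_le (a b : ℤ) : J (a + b) ≤ J a + J b := by
  rw [J, J, J, ← ENNReal.ofReal_add (Real.sqrt_nonneg _) (Real.sqrt_nonneg _)]
  refine ENNReal.ofReal_le_ofReal (Real.sqrt_le_iff.2 ⟨by positivity, ?_⟩)
  have ha : |(a : ℝ)| ≤ √(1 + (a : ℝ) ^ 2) := Real.abs_le_sqrt (by linarith)
  have hb : |(b : ℝ)| ≤ √(1 + (b : ℝ) ^ 2) := Real.abs_le_sqrt (by linarith)
  have hab := mul_le_mul ha hb (abs_nonneg _) (Real.sqrt_nonneg _)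
  rw [← abs_mul] at hab
  have ha2 := Real.sq_sqrt (show 0 ≤ 1 + (a : ℝ) ^ 2 by positivity)
  have hb2 := Real.sq_sqrt (show 0 ≤ 1 + (b : ℝ) ^ 2 by positivity)
  push_cast
  nlinarith [le_abs_self ((a : ℝ) * b)]

theorem J_add_sum_le {ι : Type*} (t : Finset ι) (a : ℤ) (p : ι → ℤ) :
    J (a + ∑ j ∈ t, p j) ≤ J a + ∑ j ∈ t, J (p j) := by
  classical
  induction t using Finset.induction_on with
  | empty => simp
  | insert i t hi ih =>
    rw [Finset.sum_insert hi, Finset.sum_insert hi, add_left_comm, add_left_comm (J a)]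
    exact (J_add_le _ _).trans (by gcongr)

theorem tsum_inv_J_sq_ne_top : ∑' k : ℤ, (J k)⁻¹ ^ 2 ≠ ∞ := by
  have h (k : ℤ) : (J k)⁻¹ ^ 2 = ENNReal.ofReal (1 + (k : ℝ) ^ 2)⁻¹ := by
    have hk : 0 < 1 + (k : ℝ) ^ 2 := by positivity
    rw [J, ← ENNReal.inv_pow, ← ENNReal.ofReal_pow (Real.sqrt_nonneg _), Real.sq_sqrt hk.le,
      ENNReal.ofReal_inv_of_pos hk]
  simp_rw [h]
  have hs : Summable fun k : ℤ => (1 + (k : ℝ) ^ 2)⁻¹ := by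
    refine Summable.of_norm_bounded_eventually (g := fun k : ℤ => 1 / (k : ℝ) ^ 2)
      (Real.summable_one_div_int_pow.2 one_lt_two) ?_
    filter_upwards [Set.Finite.compl_mem_cofinite (Set.finite_singleton (0 : ℤ))] with k hk
    have hk0 : (k : ℝ) ≠ 0 := by exact_mod_cast hk
    rw [Real.norm_of_nonneg (by positivity), one_div]
    gcongr
    linarith
  exact hs.tsum_ofReal_ne_top

theorem ENNReal.tsum_mul_sq_le {α : Type*} (f g : α → ℝ≥0∞) :
    (∑' a, f a * g a) ^ 2 ≤ (∑' a, f a ^ 2) * ∑' a, g a ^ 2 := by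
  let _ : MeasurableSpace α := ⊤
  have h := ENNReal.lintegral_mul_le_Lp_mul_Lq (MeasureTheory.Measure.count)
    Real.HolderConjugate.two_two (measurable_from_top (f := f)).aemeasurable
    (measurable_from_top (f := g)).aemeasurable
  simp only [MeasureTheory.lintegral_count, Pi.mul_apply] at h
  calc _ ≤ _ := pow_le_pow_left' h 2
    _ = _ := by
      rw [mul_pow, ← ENNReal.rpow_natCast, ← ENNReal.rpow_mul, ← ENNReal.rpow_natCast,
        ← ENNReal.rpow_mul]
      norm_num

theorem ENNReal.sum_sq_le_card_mul_sum_sq {α : Type*} [Fintype α] (f : α → ℝ≥0∞) :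
    (∑ a, f a) ^ 2 ≤ Fintype.card α * ∑ a, f a ^ 2 := by
  simpa [tsum_fintype] using ENNReal.tsum_mul_sq_le (fun _ => 1) f

theorem ENNReal.tsum_prod_le_prod_tsum {ι κ : Type*} [Fintype ι] (g : ι → κ → ℝ≥0∞) :
    ∑' p : ι → κ, ∏ l, g l (p l) ≤ ∏ l, ∑' n, g l n := by
  classical
  rw [ENNReal.tsum_eq_iSup_sum]
  refine iSup_le fun t => ?_
  calc ∑ p ∈ t, ∏ l, g l (p l)
      ≤ ∑ p ∈ Fintype.piFinset fun l => t.image fun p => p l, ∏ l, g l (p l) := by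
        refine Finset.sum_le_sum_of_subset fun p hp => ?_
        exact Fintype.mem_piFinset.2 fun l => Finset.mem_image_of_mem _ hp
    _ = ∏ l, ∑ n ∈ t.image fun p => p l, g l n := (Finset.prod_univ_sum _ _).symm
    _ ≤ _ := Finset.prod_le_prod' fun l _ => ENNReal.sum_le_tsum _

theorem tsum_tsum_fiber {ι : Type*} [Fintype ι] (F : (ι → ℤ) → ℝ≥0∞) :
    ∑' k : ℤ, ∑' p : {p : ι → ℤ // ∑ l, p l = k}, F p.1 = ∑' p, F p := by
  rw [← ENNReal.tsum_sigma fun k (p : {p : ι → ℤ // ∑ l, p l = k}) => F p.1]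
  exact (Equiv.sigmaFiberEquiv fun p : ι → ℤ => ∑ l, p l).tsum_eq F

theorem le_inv_J_mul_rpow {s : ℝ} (hs : 1 ≤ s) (n : ℤ) (x : ℝ≥0∞) :
    x ≤ (J n)⁻¹ * (J n ^ s * x) := by
  have h : J n ≤ J n ^ s := by
    simpa using ENNReal.rpow_le_rpow_of_exponent_le (one_le_J n) hs
  calc x = (J n)⁻¹ * (J n * x) := by
        rw [← mul_assoc, ENNReal.inv_mul_cancel (J_ne_zero n) (J_ne_top n), one_mul]
    _ ≤ _ := by gcongr

theorem prod_le_prod_inv_J_mul {ι : Type*} {s : ℝ} (hs : 1 ≤ s) (v : ι → ℝ≥0∞) (p : ι → ℤ)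
    (t : Finset ι) :
    ∏ l ∈ t, v l ≤ (∏ l ∈ t, (J (p l))⁻¹) * ∏ l ∈ t, J (p l) ^ s * v l := by
  rw [← Finset.prod_mul_distrib]
  exact Finset.prod_le_prod' fun l _ => le_inv_J_mul_rpow hs (p l) (v l)

section Fiber

variable {ι : Type*} [Fintype ι] [DecidableEq ι]

theorem tsum_fiber_prod_erase_le (g : ι → ℤ → ℝ≥0∞) (i : ι) (k : ℤ) :
    ∑' p : {p : ι → ℤ // ∑ l, p l = k}, ∏ l ∈ Finset.univ.erase i, g l (p.1 l)
      ≤ ∏ l ∈ Finset.univ.erase i, ∑' n, g l n := by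
  let r : {p : ι → ℤ // ∑ l, p l = k} → ({l // l ∈ Finset.univ.erase i} → ℤ) :=
    fun p l => p.1 l
  have hr : Function.Injective r := by
    rintro ⟨p, hp⟩ ⟨q, hq⟩ h
    have hne (l : ι) (hl : l ∈ Finset.univ.erase i) : p l = q l := congrFun h ⟨l, hl⟩
    have hi : p i = q i := by
      rw [← Finset.add_sum_erase _ _ (Finset.mem_univ i)] at hp hq
      rw [Finset.sum_congr rfl hne] at hp
      linarith
    refine Subtype.ext (funext fun l => ?_)
    by_cases hl : l = i
    · exact hl ▸ hi
    · exact hne l (by simpa using hl)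
  have h := ENNReal.tsum_comp_le_tsum_of_injective hr
    fun q => ∏ l : {l // l ∈ Finset.univ.erase i}, g l (q l)
  rw [← Finset.prod_coe_sort]
  refine le_trans (le_of_eq (tsum_congr fun p => ?_)) (h.trans (ENNReal.tsum_prod_le_prod_tsum _))
  exact (Finset.prod_coe_sort _ _).symm

theorem tsum_sq_fiber_diag_le (w : ι → ℤ → ℝ≥0∞) (i : ι) :
    ∑' k : ℤ, (∑' p : {p : ι → ℤ // ∑ l, p l = k},
        (∏ l ∈ Finset.univ.erase i, (J (p.1 l))⁻¹) * ∏ l, w l (p.1 l)) ^ 2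
      ≤ (∑' n, (J n)⁻¹ ^ 2) ^ (Fintype.card ι - 1) * ∏ l, ∑' n, w l n ^ 2 := by
  have hJ (k : ℤ) : ∑' p : {p : ι → ℤ // ∑ l, p l = k},
      (∏ l ∈ Finset.univ.erase i, (J (p.1 l))⁻¹) ^ 2
        ≤ (∑' n, (J n)⁻¹ ^ 2) ^ (Fintype.card ι - 1) := by
    have h := tsum_fiber_prod_erase_le (fun _ n => (J n)⁻¹ ^ 2) i k
    simp only [Finset.prod_const, Finset.card_erase_of_mem (Finset.mem_univ i),
      Finset.card_univ, Finset.prod_pow] at h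
    exact h
  calc _ ≤ ∑' k : ℤ, (∑' n, (J n)⁻¹ ^ 2) ^ (Fintype.card ι - 1) *
        ∑' p : {p : ι → ℤ // ∑ l, p l = k}, (∏ l, w l (p.1 l)) ^ 2 :=
        ENNReal.tsum_le_tsum fun k => (ENNReal.tsum_mul_sq_le _ _).trans (by gcongr; exact hJ k)
    _ ≤ _ := by
      rw [ENNReal.tsum_mul_left, tsum_tsum_fiber fun p => (∏ l, w l (p l)) ^ 2]
      gcongr
      simp_rw [← Finset.prod_pow]
      exact ENNReal.tsum_prod_le_prod_tsum fun l n => w l n ^ 2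

theorem sq_tsum_fiber_offdiag_le (w : ι → ℤ → ℝ≥0∞) {i j : ι} (hij : i ≠ j) (k : ℤ) :
    (∑' p : {p : ι → ℤ // ∑ l, p l = k},
        (∏ l ∈ (Finset.univ.erase i).erase j, (J (p.1 l))⁻¹) * ∏ l, w l (p.1 l)) ^ 2
      ≤ (∑' n, (J n)⁻¹ ^ 2) ^ (Fintype.card ι - 2) * ∏ l, ∑' n, w l n ^ 2 := by
  have hi : i ∈ Finset.univ.erase j := by simpa using hij
  have hw (S : ι → ℝ≥0∞) : ∏ l, S l = S i * ∏ l ∈ Finset.univ.erase i, S l :=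
    (Finset.mul_prod_erase _ _ (Finset.mem_univ i)).symm
  have h1 : ∑' p : {p : ι → ℤ // ∑ l, p l = k},
      ((∏ l ∈ (Finset.univ.erase i).erase j, (J (p.1 l))⁻¹) * w i (p.1 i)) ^ 2
        ≤ (∑' n, (J n)⁻¹ ^ 2) ^ (Fintype.card ι - 2) * ∑' n, w i n ^ 2 := by
    have h := tsum_fiber_prod_erase_le
      (fun l n => if l = i then w i n ^ 2 else (J n)⁻¹ ^ 2) j k
    have he (S T : ι → ℝ≥0∞) : ∏ l ∈ Finset.univ.erase j, (if l = i then S l else T l)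
        = (∏ l ∈ (Finset.univ.erase i).erase j, T l) * S i := by
      rw [← Finset.mul_prod_erase _ _ hi, if_pos rfl, mul_comm, Finset.erase_right_comm]
      refine congrArg (· * S i) (Finset.prod_congr rfl fun l hl => if_neg ?_)
      simp only [Finset.mem_erase] at hl
      tauto
    have hs (l : ι) : ∑' n, (if l = i then w i n ^ 2 else (J n)⁻¹ ^ 2)
        = if l = i then ∑' n, w i n ^ 2 else ∑' n, (J n)⁻¹ ^ 2 := by
      split_ifs <;> rfl
    simp only [hs] at h
    rw [he (fun _ => ∑' n, w i n ^ 2) fun _ => ∑' n, (J n)⁻¹ ^ 2, Finset.prod_const,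
      Finset.card_erase_of_mem (by simpa using hij.symm),
      Finset.card_erase_of_mem (Finset.mem_univ i), Finset.card_univ, Nat.sub_sub] at h
    refine le_trans (le_of_eq (tsum_congr fun p => ?_)) h
    rw [he (fun l => w i (p.1 l) ^ 2) fun l => (J (p.1 l))⁻¹ ^ 2, mul_pow, Finset.prod_pow]
  have h2 := tsum_fiber_prod_erase_le (fun l n => w l n ^ 2) i k
  simp only [Finset.prod_pow] at h2
  simp_rw [hw, ← mul_assoc]
  exact (ENNReal.tsum_mul_sq_le _ _).trans (mul_le_mul' h1 h2)

theorem J_rpow_mul_sq_le {s : ℝ} (hs : 1 ≤ s) (p : ι → ℤ) (i : ι)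
    (hi : ∀ j, J (p j) ≤ J (p i)) :
    J (∑ l, p l) ^ (s - 3) * (J (∑ l, p l) * J (p i) ^ 2)
      ≤ (Fintype.card ι : ℝ≥0∞) ^ (s - 1) *
        (J (p i) ^ s + (J (∑ l, p l))⁻¹ *
          ∑ j ∈ Finset.univ.erase i, J (p i) ^ s * J (p j)) := by
  set k := ∑ l, p l with hk
  have hksum : p i + ∑ j ∈ Finset.univ.erase i, p j = k :=
    Finset.add_sum_erase _ _ (Finset.mem_univ i)
  have hkle : J k ≤ Fintype.card ι * J (p i) := by
    calc J k ≤ J (p i) + ∑ j ∈ Finset.univ.erase i, J (p j) := hksum ▸ J_add_sum_le _ _ _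
      _ = ∑ j, J (p j) := Finset.add_sum_erase _ (fun j => J (p j)) (Finset.mem_univ i)
      _ ≤ ∑ _j : ι, J (p i) := Finset.sum_le_sum fun j _ => hi j
      _ = _ := by simp
  have hile : J (p i) ≤ J k + ∑ j ∈ Finset.univ.erase i, J (p j) := by
    have h := J_add_sum_le (Finset.univ.erase i) k fun j => -p j
    simp only [J_neg, Finset.sum_neg_distrib] at h
    rwa [← hksum, add_neg_cancel_right, hksum] at h
  have hpow : J k ^ (s - 3) * J k = J k ^ (s - 1) * (J k)⁻¹ := by
    nth_rewrite 2 [← ENNReal.rpow_one (J k)]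
    rw [← ENNReal.rpow_neg_one, ← ENNReal.rpow_add _ _ (J_ne_zero k) (J_ne_top k),
      ← ENNReal.rpow_add _ _ (J_ne_zero k) (J_ne_top k)]
    congr 1
    ring
  have hmax : J (p i) ^ (s - 1) * J (p i) ^ 2 = J (p i) ^ s * J (p i) := by
    rw [sq, ← mul_assoc]
    congr 1
    nth_rewrite 2 [← ENNReal.rpow_one (J (p i))]
    rw [← ENNReal.rpow_add _ _ (J_ne_zero _) (J_ne_top _), sub_add_cancel]
  calc J k ^ (s - 3) * (J k * J (p i) ^ 2)
      = J k ^ (s - 1) * ((J k)⁻¹ * J (p i) ^ 2) := by rw [← mul_assoc, hpow, mul_assoc]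
    _ ≤ (Fintype.card ι * J (p i)) ^ (s - 1) * ((J k)⁻¹ * J (p i) ^ 2) := by
      gcongr
    _ = (Fintype.card ι : ℝ≥0∞) ^ (s - 1) * ((J k)⁻¹ * (J (p i) ^ s * J (p i))) := by
      rw [ENNReal.mul_rpow_of_nonneg _ _ (by linarith), ← hmax]
      ring
    _ ≤ (Fintype.card ι : ℝ≥0∞) ^ (s - 1) * ((J k)⁻¹ *
          (J (p i) ^ s * (J k + ∑ j ∈ Finset.univ.erase i, J (p j)))) := by gcongr
    _ = _ := by
      rw [mul_add, mul_add, mul_left_comm _ _ (J k),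
        ENNReal.inv_mul_cancel (J_ne_zero k) (J_ne_top k), mul_one, Finset.mul_sum]

theorem rpow_mul_prod_le {s : ℝ} (hs : 1 ≤ s) (v : ι → ℝ≥0∞) (p : ι → ℤ) (i : ι) :
    J (p i) ^ s * ∏ l, v l
      ≤ (∏ l ∈ Finset.univ.erase i, (J (p l))⁻¹) * ∏ l, J (p l) ^ s * v l := by
  rw [← Finset.mul_prod_erase _ v (Finset.mem_univ i),
    ← Finset.mul_prod_erase _ (fun l => J (p l) ^ s * v l) (Finset.mem_univ i),
    mul_left_comm _ (J (p i) ^ s * v i), ← mul_assoc]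
  gcongr
  exact prod_le_prod_inv_J_mul hs v p _

theorem rpow_mul_mul_prod_le {s : ℝ} (hs : 1 ≤ s) (v : ι → ℝ≥0∞) (p : ι → ℤ) {i j : ι}
    (hij : i ≠ j) :
    J (p i) ^ s * J (p j) * ∏ l, v l
      ≤ (∏ l ∈ (Finset.univ.erase i).erase j, (J (p l))⁻¹) * ∏ l, J (p l) ^ s * v l := by
  have hj : j ∈ Finset.univ.erase i := by simpa using hij.symm
  calc J (p i) ^ s * J (p j) * ∏ l, v l = J (p j) * (J (p i) ^ s * ∏ l, v l) := by ring
    _ ≤ J (p j) * ((∏ l ∈ Finset.univ.erase i, (J (p l))⁻¹) * ∏ l, J (p l) ^ s * v l) := by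
      exact mul_le_mul_right (rpow_mul_prod_le hs v p i) _
    _ = _ := by
      rw [← Finset.mul_prod_erase _ (fun l => (J (p l))⁻¹) hj, ← mul_assoc, ← mul_assoc,
        ENNReal.mul_inv_cancel (J_ne_zero _) (J_ne_top _), one_mul]

/-- The `(i, j)` contribution to the weighted convolution, with `i` the index of the largest
frequency: the low-frequency case for `i = j`, and the resonant case for `i ≠ j`. -/
noncomputable def convTerm (w : ι → ℤ → ℝ≥0∞) (i j : ι) (p : ι → ℤ) : ℝ≥0∞ :=
  if i = j then (∏ l ∈ Finset.univ.erase i, (J (p l))⁻¹) * ∏ l, w l (p l)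
  else (J (∑ l, p l))⁻¹ *
    ((∏ l ∈ (Finset.univ.erase i).erase j, (J (p l))⁻¹) * ∏ l, w l (p l))

theorem tsum_sq_fiber_convTerm_le (w : ι → ℤ → ℝ≥0∞) (i j : ι) :
    ∑' k : ℤ, (∑' p : {p : ι → ℤ // ∑ l, p l = k}, convTerm w i j p.1) ^ 2
      ≤ (∑' n, (J n)⁻¹ ^ 2) ^ (Fintype.card ι - 1) * ∏ l, ∑' n, w l n ^ 2 := by
  by_cases hij : i = j
  · simp only [convTerm, if_pos hij]
    exact tsum_sq_fiber_diag_le w i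
  · have hcard : Fintype.card ι - 1 = 1 + (Fintype.card ι - 2) := by
      have := Fintype.one_lt_card_iff.2 ⟨i, j, hij⟩
      omega
    rw [hcard, pow_add, pow_one, mul_assoc, ← ENNReal.tsum_mul_right]
    refine ENNReal.tsum_le_tsum fun k => ?_
    calc _ = ((J k)⁻¹ * ∑' p : {p : ι → ℤ // ∑ l, p l = k},
          (∏ l ∈ (Finset.univ.erase i).erase j, (J (p.1 l))⁻¹) * ∏ l, w l (p.1 l)) ^ 2 := by
          rw [← ENNReal.tsum_mul_left]
          congr 1
          refine tsum_congr fun p => ?_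
          rw [convTerm, if_neg hij, p.2]
      _ ≤ _ := by
        rw [mul_pow]
        gcongr
        exact sq_tsum_fiber_offdiag_le w hij k

theorem weight_mul_prod_le_sum_convTerm [Nonempty ι] {s : ℝ} (hs : 1 ≤ s)
    (v : ι → ℤ → ℝ≥0∞) (p : ι → ℤ) :
    J (∑ l, p l) ^ (s - 3) *
        (J (∑ l, p l) * (Finset.univ.sup fun j => J (p j)) ^ 2 * ∏ l, v l (p l))
      ≤ (Fintype.card ι : ℝ≥0∞) ^ (s - 1) *
        ∑ a : ι × ι, convTerm (fun l n => J n ^ s * v l n) a.1 a.2 p := by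
  obtain ⟨i, -, hi⟩ := Finset.exists_mem_eq_sup Finset.univ Finset.univ_nonempty
    fun j => J (p j)
  have hmax (j : ι) : J (p j) ≤ J (p i) :=
    hi ▸ Finset.le_sup (f := fun j => J (p j)) (Finset.mem_univ j)
  rw [hi, ← mul_assoc]
  refine (mul_le_mul_left (J_rpow_mul_sq_le hs p i hmax) _).trans ?_
  rw [mul_assoc]
  gcongr
  rw [Fintype.sum_prod_type]
  refine le_trans ?_ (Finset.single_le_sum_of_canonicallyOrdered
    (f := fun i => ∑ j, convTerm (fun l n => J n ^ s * v l n) i j p) (Finset.mem_univ i))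
  rw [← Finset.add_sum_erase _ (fun j => convTerm _ i j p) (Finset.mem_univ i), add_mul,
    Finset.mul_sum, Finset.sum_mul]
  refine add_le_add ?_ (Finset.sum_le_sum fun j hj => ?_)
  · simp only [convTerm, if_true]
    exact rpow_mul_prod_le hs (fun l => v l (p l)) p i
  · have hij : i ≠ j := (Finset.ne_of_mem_erase hj).symm
    rw [convTerm, if_neg hij, mul_assoc]
    exact mul_le_mul_right (rpow_mul_mul_prod_le hs (fun l => v l (p l)) p hij) _

theorem tsum_weight_mul_sq_conv_le [Nonempty ι] {s : ℝ} (hs : 1 ≤ s) (v : ι → ℤ → ℝ≥0∞) :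
    ∑' k : ℤ, J k ^ (2 * (s - 3)) *
        (∑' p : ι → ℤ, if (∑ j, p j) = k then
            J k * (Finset.univ.sup fun j => J (p j)) ^ 2 * ∏ l, v l (p l)
          else 0) ^ 2
      ≤ ((Fintype.card ι : ℝ≥0∞) ^ (s - 1)) ^ 2 * (Fintype.card (ι × ι) *
          (Fintype.card (ι × ι) * (∑' n, (J n)⁻¹ ^ 2) ^ (Fintype.card ι - 1))) *
        ∏ l, ∑' n, J n ^ (2 * s) * v l n ^ 2 := by
  set w : ι → ℤ → ℝ≥0∞ := fun l n => J n ^ s * v l n with hw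
  have hrpow (n : ℤ) (x : ℝ) : J n ^ (2 * x) = (J n ^ x) ^ 2 := by
    rw [mul_comm, ENNReal.rpow_mul, ENNReal.rpow_two]
  have hwsq (l : ι) (n : ℤ) : J n ^ (2 * s) * v l n ^ 2 = w l n ^ 2 := by
    rw [hw, hrpow, mul_pow]
  simp_rw [hwsq, hrpow, ← mul_pow]
  set T : ι × ι → ℤ → ℝ≥0∞ := fun a k =>
    ∑' p : {p : ι → ℤ // ∑ l, p l = k}, convTerm w a.1 a.2 p.1 with hT
  have hfiber (k : ℤ) : J k ^ (s - 3) * (∑' p : ι → ℤ, if (∑ j, p j) = k then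
      J k * (Finset.univ.sup fun j => J (p j)) ^ 2 * ∏ l, v l (p l) else 0)
        ≤ (Fintype.card ι : ℝ≥0∞) ^ (s - 1) * ∑ a, T a k := by
    have hsub := tsum_subtype {p : ι → ℤ | ∑ l, p l = k} fun p =>
      J k * (Finset.univ.sup fun j => J (p j)) ^ 2 * ∏ l, v l (p l)
    simp only [Set.indicator_apply, Set.mem_ofPred_eq] at hsub
    rw [← hsub, ← ENNReal.tsum_mul_left, hT]
    simp only
    rw [← Summable.tsum_finsetSum fun _ _ => ENNReal.summable, ← ENNReal.tsum_mul_left]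
    refine ENNReal.tsum_le_tsum fun p => ?_
    have h := weight_mul_prod_le_sum_convTerm hs v p.1
    rwa [show ∑ l, p.1 l = k from p.2] at h
  calc _ ≤ ∑' k, ((Fintype.card ι : ℝ≥0∞) ^ (s - 1)) ^ 2 *
        (Fintype.card (ι × ι) * ∑ a, T a k ^ 2) := by
        refine ENNReal.tsum_le_tsum fun k => (pow_le_pow_left' (hfiber k) 2).trans ?_
        rw [mul_pow]
        gcongr
        exact ENNReal.sum_sq_le_card_mul_sum_sq _
    _ = ((Fintype.card ι : ℝ≥0∞) ^ (s - 1)) ^ 2 *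
        (Fintype.card (ι × ι) * ∑ a, ∑' k, T a k ^ 2) := by
        rw [ENNReal.tsum_mul_left, ENNReal.tsum_mul_left,
          Summable.tsum_finsetSum fun _ _ => ENNReal.summable]
    _ ≤ ((Fintype.card ι : ℝ≥0∞) ^ (s - 1)) ^ 2 * (Fintype.card (ι × ι) * ∑ _a : ι × ι,
        ((∑' n, (J n)⁻¹ ^ 2) ^ (Fintype.card ι - 1) * ∏ l, ∑' n, w l n ^ 2)) := by
        gcongr with a
        exact tsum_sq_fiber_convTerm_le w a.1 a.2
    _ = _ := by
        rw [Finset.sum_const, Finset.card_univ, nsmul_eq_mul]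
        ring

end Fiber

/-- Multilinear estimate with loss of derivatives: the `⟨k⟩⟨k_max⟩²`-weighted convolution
is bounded in `l²_{s-3}` by the product of `H^s` norms, for `s ≥ 1`. -/
theorem multilinear_loss_estimate (s : ℝ) (hs : 1 ≤ s) (N : ℕ) (hN : 1 ≤ N) :
    ∃ C : ℝ, 0 < C ∧ ∀ v : Fin N → ℤ → ℝ≥0,
      (∑' k : ℤ, J k ^ (2 * (s - 3)) *
          (∑' p : Fin N → ℤ, if (∑ j, p j) = k then
              J k * (Finset.univ.sup fun j => J (p j)) ^ (2 : ℕ) *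
                ∏ l, (v l (p l) : ℝ≥0∞)
            else 0) ^ (2 : ℕ)) ^ ((1 : ℝ) / 2)
      ≤ ENNReal.ofReal C *
          ∏ l, (∑' k : ℤ, J k ^ (2 * s) * (v l k : ℝ≥0∞) ^ (2 : ℕ)) ^ ((1 : ℝ) / 2) := by
  have : Nonempty (Fin N) := ⟨⟨0, hN⟩⟩
  set K : ℝ≥0∞ := ((Fintype.card (Fin N) : ℝ≥0∞) ^ (s - 1)) ^ 2 *
    (Fintype.card (Fin N × Fin N) * (Fintype.card (Fin N × Fin N) *
      (∑' n, (J n)⁻¹ ^ 2) ^ (Fintype.card (Fin N) - 1)))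
  have hK_top : K ≠ ∞ := by
    refine ENNReal.mul_ne_top (ENNReal.pow_ne_top (ENNReal.rpow_ne_top_of_nonneg
      (by linarith) (ENNReal.natCast_ne_top _))) ?_
    exact ENNReal.mul_ne_top (ENNReal.natCast_ne_top _) (ENNReal.mul_ne_top
      (ENNReal.natCast_ne_top _) (ENNReal.pow_ne_top tsum_inv_J_sq_ne_top))
  have hK_sqrt : K ^ ((1 : ℝ) / 2) ≠ ∞ := ENNReal.rpow_ne_top_of_nonneg (by norm_num) hK_top
  refine ⟨(K ^ ((1 : ℝ) / 2)).toReal + 1, by positivity, fun v => ?_⟩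
  have hC : K ^ ((1 : ℝ) / 2) ≤ ENNReal.ofReal ((K ^ ((1 : ℝ) / 2)).toReal + 1) :=
    (ENNReal.ofReal_toReal hK_sqrt).symm.trans_le (ENNReal.ofReal_le_ofReal (by linarith))
  calc _ ≤ (K * ∏ l, ∑' k, J k ^ (2 * s) * (v l k : ℝ≥0∞) ^ 2) ^ ((1 : ℝ) / 2) :=
        ENNReal.rpow_le_rpow (tsum_weight_mul_sq_conv_le hs fun l n => (v l n : ℝ≥0∞))
          (by norm_num)
    _ ≤ _ := by
        rw [ENNReal.mul_rpow_of_nonneg _ _ (by norm_num),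
          ENNReal.prod_rpow_of_nonneg (by norm_num)]
        gcongr
end
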